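/- Let B be an nbc-base of 𝒜 and let H ∈ B. Then there exists H' < H in 𝒜 such that (B ∖ {H}) ∪ {H'} is an nbc-base if and only if there exists H' < H in 𝒜 such that (B ∖ {H}) ∪ {H'} is a base. -/

import Mathlib

open Module

noncomputable section

/-- An arrangement of `n` (affine) hyperplanes inside the ambient affine subspace `amb`
of the complex vector space `W`.  The linear order on the hyperplanes is the order of the
indices in `Fin n`; an arbitrary linear order is encoded by a permutation `σ` of `Fin n`,
with `i ≺ j ↔ σ i < σ j`. -/
structure HArr (W : Type) [AddCommGroup W] [Module ℂ W] (n : ℕ) where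
  amb : AffineSubspace ℂ W
  amb_ne : (amb : Set W).Nonempty
  H : Fin n → AffineSubspace ℂ W
  inj : Function.Injective H
  le_amb : ∀ i, H i ≤ amb
  nonemptyH : ∀ i, ((H i : Set W)).Nonempty
  hyp : ∀ i, finrank ℂ (H i).direction + 1 = finrank ℂ amb.direction

namespace HArr

variable {W : Type} [AddCommGroup W] [Module ℂ W] {n : ℕ}

/-- The intersection `⋂ S` of a subset of the arrangement (the ambient space for `S = ∅`). -/
def inter (A : HArr W n) (S : Finset (Fin n)) : AffineSubspace ℂ W :=
  A.amb ⊓ S.inf A.H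

/-- Codimension (inside the ambient space) of an affine subspace. -/
def cd (A : HArr W n) (X : AffineSubspace ℂ W) : ℕ :=
  finrank ℂ A.amb.direction - finrank ℂ X.direction

/-- A dependent subset of the arrangement. -/
def dep (A : HArr W n) (S : Finset (Fin n)) : Prop :=
  A.inter S ≠ ⊥ ∧ A.cd (A.inter S) < S.card

/-- An independent subset of the arrangement. -/
def indep (A : HArr W n) (S : Finset (Fin n)) : Prop :=
  A.inter S ≠ ⊥ ∧ A.cd (A.inter S) = S.card

/-- A base: a maximal independent subset. -/
def isBase (A : HArr W n) (S : Finset (Fin n)) : Prop :=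
  A.indep S ∧ ∀ T, A.indep T → S ⊆ T → S = T

open scoped Classical in
/-- The rank of a subarrangement `{H i : i ∈ C}`. -/
def rankOn (A : HArr W n) (C : Finset (Fin n)) : ℕ :=
  C.powerset.sup fun S => if A.indep S then S.card else 0

/-- The rank `r` of the arrangement. -/
def rank (A : HArr W n) : ℕ := A.rankOn Finset.univ

/-- A circuit: an inclusion-minimal dependent set. -/
def circuit (A : HArr W n) (S : Finset (Fin n)) : Prop :=
  A.dep S ∧ ∀ T ⊂ S, ¬ A.dep T

/-- A broken circuit w.r.t. the linear order given by `σ`. -/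
def brokenCircuit (A : HArr W n) (σ : Equiv.Perm (Fin n)) (S : Finset (Fin n)) : Prop :=
  ∃ i ∉ S, (∀ j ∈ S, σ i < σ j) ∧ A.circuit (insert i S)

/-- An nbc set: nonempty intersection and containing no broken circuit. -/
def nbcSet (A : HArr W n) (σ : Equiv.Perm (Fin n)) (S : Finset (Fin n)) : Prop :=
  A.inter S ≠ ⊥ ∧ ∀ T ⊆ S, ¬ A.brokenCircuit σ T

/-- An nbc-base. -/
def nbcBase (A : HArr W n) (σ : Equiv.Perm (Fin n)) (S : Finset (Fin n)) : Prop :=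
  A.nbcSet σ S ∧ A.isBase S

/-- A βnbc-base. -/
def betaNbcBase (A : HArr W n) (σ : Equiv.Perm (Fin n)) (S : Finset (Fin n)) : Prop :=
  A.nbcBase σ S ∧ ∀ i ∈ S, ∃ j, σ j < σ i ∧ A.isBase (insert j (S.erase i))

/-- Membership in the intersection poset `L(𝒜)`. -/
def memL (A : HArr W n) (X : AffineSubspace ℂ W) : Prop :=
  X ≠ ⊥ ∧ ∃ S : Finset (Fin n), A.inter S = X

/-- A maximal element of `L(𝒜)` (in the reverse-inclusion order). -/
def maximalL (A : HArr W n) (X : AffineSubspace ℂ W) : Prop :=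
  A.memL X ∧ ∀ Y, A.memL Y → Y ≤ X → Y = X

open scoped Classical in
/-- The set of indices of hyperplanes containing `X`, i.e. `𝒜_X`. -/
def sub (A : HArr W n) (X : AffineSubspace ℂ W) : Finset (Fin n) :=
  Finset.univ.filter fun i => X ≤ A.H i

/-- `X` is dense: `𝒜_X` admits no decomposition into two nonempty parts. -/
def denseL (A : HArr W n) (X : AffineSubspace ℂ W) : Prop :=
  ¬ ∃ S T : Finset (Fin n), Disjoint S T ∧ S.Nonempty ∧ T.Nonempty ∧
      S ∪ T = A.sub X ∧ A.cd (A.inter S) + A.cd (A.inter T) = A.cd X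

/-- `i` is the minimum of `S` w.r.t. the linear order given by `σ`. -/
def isMin (σ : Equiv.Perm (Fin n)) (i : Fin n) (S : Finset (Fin n)) : Prop :=
  i ∈ S ∧ ∀ j ∈ S, σ i ≤ σ j

/-- The standard ordered tuple of a finite set, w.r.t. the linear order given by `σ`:
`tup σ S p` is the element of `S` with `(p+1)`-st smallest `σ`-value. -/
def tup (σ : Equiv.Perm (Fin n)) (S : Finset (Fin n)) (p : Fin S.card) : Fin n :=
  σ.symm (((S.image ⇑σ).orderIsoOfFin (Finset.card_image_of_injective S σ.injective) p).1)

/-- The flag `ξ(B) = (X_1 > ⋯ > X_r)` of a standard ordered base: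
`flag σ S p = X_{p+1} = ⋂_{k ≥ p} H_{i_k}`. -/
def flag (A : HArr W n) (σ : Equiv.Perm (Fin n)) (S : Finset (Fin n)) (p : Fin S.card) :
    AffineSubspace ℂ W :=
  A.inter (S.filter fun i => σ (tup σ S p) ≤ σ i)

/-- Lexicographic order on standard ordered tuples (for the canonical order). -/
def lexLt (S T : Finset (Fin n)) : Prop :=
  List.Lex (· < ·) (S.sort (· ≤ ·)) (T.sort (· ≤ ·))

/-- `λ(X) = Σ_{H_i ∈ 𝒜_X} λ_i`. -/
def lamX (A : HArr W n) (lam : Fin n → ℂ) (X : AffineSubspace ℂ W) : ℂ :=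
  ∑ i ∈ A.sub X, lam i

/-- `X` is unmixed (w.r.t. the order `σ`). -/
def unmixedX (A : HArr W n) (σ : Equiv.Perm (Fin n)) (X : AffineSubspace ℂ W) : Prop :=
  (∀ S, A.nbcBase σ S → A.inter S = X → A.betaNbcBase σ S) ∨
  (∀ S, A.nbcBase σ S → A.inter S = X → ¬ A.betaNbcBase σ S)

/-- The linear order given by `σ` is unmixed. -/
def unmixedOrd (A : HArr W n) (σ : Equiv.Perm (Fin n)) : Prop :=
  ∀ X, A.maximalL X → A.unmixedX σ X

/-- Membership in the intersection poset of the deleted arrangement `𝒜 ∖ {H_{i₀}}`. -/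
def memLdel (A : HArr W n) (i₀ : Fin n) (X : AffineSubspace ℂ W) : Prop :=
  X ≠ ⊥ ∧ ∃ S : Finset (Fin n), i₀ ∉ S ∧ A.inter S = X

/-- A maximal element of the intersection poset of the deleted arrangement. -/
def maximalLdel (A : HArr W n) (i₀ : Fin n) (X : AffineSubspace ℂ W) : Prop :=
  A.memLdel i₀ X ∧ ∀ Y, A.memLdel i₀ Y → Y ≤ X → Y = X

/-- The generator `e_i` of the exterior algebra `E`. -/
def gen (i : Fin n) : ExteriorAlgebra ℂ (Fin n → ℂ) :=
  ExteriorAlgebra.ι ℂ (Pi.single i 1)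

/-- `e_S = e_{i_1} ∧ ⋯ ∧ e_{i_p}` for `S = {i_1 < ⋯ < i_p}`. -/
def eS (S : Finset (Fin n)) : ExteriorAlgebra ℂ (Fin n → ℂ) :=
  ((S.sort (· ≤ ·)).map gen).prod

/-- `∂e_S = Σ_k (−1)^{k−1} e_{S ∖ {i_k}}`. -/
def bdry (S : Finset (Fin n)) : ExteriorAlgebra ℂ (Fin n → ℂ) :=
  ∑ i ∈ S, ((-1 : ℂ) ^ (S.filter fun j => j < i).card) • eS (S.erase i)

/-- The defining relations of the Orlik–Solomon algebra. -/
inductive OSRel (A : HArr W n) :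
    ExteriorAlgebra ℂ (Fin n → ℂ) → ExteriorAlgebra ℂ (Fin n → ℂ) → Prop
  | isBot : ∀ S : Finset (Fin n), A.inter S = ⊥ → OSRel A (eS S) 0
  | isDep : ∀ S : Finset (Fin n), A.dep S → OSRel A (bdry S) 0

/-- The Orlik–Solomon algebra `A(𝒜)`: the exterior algebra modulo the ideal generated by
the `e_S` with empty intersection and the `∂e_S` with `S` dependent. -/
abbrev OS (A : HArr W n) := RingQuot (OSRel A)

/-- The quotient map `E → A(𝒜)`. -/
def osMk (A : HArr W n) : ExteriorAlgebra ℂ (Fin n → ℂ) →ₐ[ℂ] OS A :=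
  RingQuot.mkAlgHom ℂ (OSRel A)

/-- `ω_i`, the image of `e_i` in the Orlik–Solomon algebra. -/
def om (A : HArr W n) (i : Fin n) : OS A := osMk A (gen i)

/-- `ω_B`, the image of `e_B` in the Orlik–Solomon algebra. -/
def omB (A : HArr W n) (S : Finset (Fin n)) : OS A := osMk A (eS S)

/-- The degree `p` part `A^p` of the Orlik–Solomon algebra. -/
def deg (A : HArr W n) (p : ℕ) : Submodule ℂ (OS A) :=
  Submodule.span ℂ {x | ∃ S : Finset (Fin n), S.card = p ∧ x = omB A S}

/-- `ω_λ = Σ_i λ_i ω_i`. -/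
def omLam (A : HArr W n) (lam : Fin n → ℂ) : OS A := ∑ i, lam i • om A i

/-- `ω_λ(X) = Σ_{H_i ∈ 𝒜_X} λ_i ω_i`. -/
def omLamX (A : HArr W n) (lam : Fin n → ℂ) (X : AffineSubspace ℂ W) : OS A :=
  ∑ i ∈ A.sub X, lam i • om A i

/-- The form `Ξ(B) = ω_λ(X_1) ⋯ ω_λ(X_r)` attached to a standard ordered base. -/
def Xi (A : HArr W n) (σ : Equiv.Perm (Fin n)) (lam : Fin n → ℂ) (S : Finset (Fin n)) :
    OS A :=
  ((List.finRange S.card).map fun p => A.omLamX lam (A.flag σ S p)).prod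

/-- The submodule `ω_λ ∧ A^p` of the Orlik-Solomon algebra. -/
def Ideg (A : HArr W n) (lam : Fin n → ℂ) (p : ℕ) : Submodule ℂ (OS A) :=
  (A.deg p).map (LinearMap.mulLeft ℂ (A.omLam lam))

end HArr

namespace HArr

section Matroid

variable {W : Type} [AddCommGroup W] [Module ℂ W] {n : ℕ} (A : HArr W n)

theorem inter_empty : A.inter ∅ = A.amb := by
  simp [inter]

theorem inter_insert (k : Fin n) (S : Finset (Fin n)) :
    A.inter (insert k S) = A.inter S ⊓ A.H k := by
  rw [inter, inter, Finset.inf_insert, inf_assoc, inf_comm (A.H k)]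

theorem inter_anti {S T : Finset (Fin n)} (h : S ⊆ T) : A.inter T ≤ A.inter S :=
  inf_le_inf_left _ (Finset.inf_mono h)

theorem inter_le_amb (S : Finset (Fin n)) : A.inter S ≤ A.amb := inf_le_left

theorem inter_le_H {S : Finset (Fin n)} {k : Fin n} (h : k ∈ S) : A.inter S ≤ A.H k :=
  inf_le_right.trans (Finset.inf_le h)

variable {A} in
theorem inter_ne_bot_of_subset {S T : Finset (Fin n)} (h : S ⊆ T) (hT : A.inter T ≠ ⊥) :
    A.inter S ≠ ⊥ :=
  fun hS => hT (le_bot_iff.1 (hS ▸ A.inter_anti h))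

variable [FiniteDimensional ℂ W]

theorem cd_anti {X Y : AffineSubspace ℂ W} (h : X ≤ Y) : A.cd Y ≤ A.cd X :=
  Nat.sub_le_sub_left (Submodule.finrank_mono (AffineSubspace.direction_le h)) _

theorem eq_of_le_of_cd_le {X Y : AffineSubspace ℂ W} (hX : X ≠ ⊥) (h : X ≤ Y) (hY : Y ≤ A.amb)
    (hcd : A.cd X ≤ A.cd Y) : X = Y := by
  have h₁ := Submodule.finrank_mono (AffineSubspace.direction_le h)
  have h₂ := Submodule.finrank_mono (AffineSubspace.direction_le hY)
  refine AffineSubspace.eq_of_direction_eq_of_nonempty_of_le ?_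
    ((AffineSubspace.nonempty_iff_ne_bot X).2 hX) h
  refine Submodule.eq_of_le_of_finrank_eq (AffineSubspace.direction_le h) ?_
  simp only [cd] at hcd
  omega

theorem cd_inf_H_le {X : AffineSubspace ℂ W} (k : Fin n) (hX : X ≤ A.amb) (h : X ⊓ A.H k ≠ ⊥) :
    A.cd (X ⊓ A.H k) ≤ A.cd X + 1 := by
  obtain ⟨p, hp⟩ := (AffineSubspace.nonempty_iff_ne_bot _).2 h
  have h₁ := Submodule.finrank_sup_add_finrank_inf_eq X.direction (A.H k).direction
  have h₂ : finrank ℂ ↥(X.direction ⊔ (A.H k).direction) ≤ finrank ℂ A.amb.direction :=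
    Submodule.finrank_mono (sup_le (AffineSubspace.direction_le hX)
      (AffineSubspace.direction_le (A.le_amb k)))
  have h₃ := A.hyp k
  rw [cd, cd, AffineSubspace.direction_inf_of_mem hp.1 hp.2]
  omega

theorem cd_inter_union_le (S T : Finset (Fin n)) (h : A.inter (S ∪ T) ≠ ⊥) :
    A.cd (A.inter (S ∪ T)) ≤ A.cd (A.inter S) + T.card := by
  induction T using Finset.induction_on with
  | empty => simp
  | insert k T hk ih =>
    rw [Finset.union_insert] at h ⊢
    have ih := ih (inter_ne_bot_of_subset (Finset.subset_insert _ _) h)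
    rw [inter_insert] at h ⊢
    have := A.cd_inf_H_le k (A.inter_le_amb _) h
    rw [Finset.card_insert_of_notMem hk]
    omega

theorem cd_inter_le_card (S : Finset (Fin n)) (h : A.inter S ≠ ⊥) :
    A.cd (A.inter S) ≤ S.card := by
  have h₁ := A.cd_inter_union_le ∅ S (by rwa [Finset.empty_union])
  have h₂ : A.cd (A.inter ∅) = 0 := by rw [inter_empty, cd, Nat.sub_self]
  rwa [Finset.empty_union, h₂, zero_add] at h₁

variable {A}

theorem indep.subset {S T : Finset (Fin n)} (hT : A.indep T) (h : S ⊆ T) : A.indep S := by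
  have hS := inter_ne_bot_of_subset h hT.1
  refine ⟨hS, le_antisymm (A.cd_inter_le_card S hS) ?_⟩
  have h₁ := A.cd_inter_union_le S (T \ S) (by rw [Finset.union_sdiff_of_subset h]; exact hT.1)
  rw [Finset.union_sdiff_of_subset h, hT.2] at h₁
  have := Finset.card_sdiff_add_card_eq_card h
  omega

theorem circuit.inter_erase {C : Finset (Fin n)} (hC : A.circuit C) {c : Fin n} (hc : c ∈ C) :
    A.inter (C.erase c) = A.inter C := by
  have hne := inter_ne_bot_of_subset (Finset.erase_subset c C) hC.1.1
  have hcard : C.card - 1 ≤ A.cd (A.inter (C.erase c)) := by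
    by_contra h
    exact hC.2 _ (Finset.erase_ssubset hc)
      ⟨hne, by rw [Finset.card_erase_of_mem hc]; omega⟩
  have hlt := hC.1.2
  exact (A.eq_of_le_of_cd_le hC.1.1 (A.inter_anti (Finset.erase_subset c C))
    (A.inter_le_amb _) (by omega)).symm

theorem circuit.inter_erase_of_subset {C D : Finset (Fin n)} (hC : A.circuit C) (h : C ⊆ D)
    {c : Fin n} (hc : c ∈ C) : A.inter (D.erase c) = A.inter D := by
  have hle : A.inter (D.erase c) ≤ A.H c :=
    (A.inter_anti (Finset.erase_subset_erase c h)).trans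
      ((hC.inter_erase hc).le.trans (A.inter_le_H hc))
  conv_rhs => rw [← Finset.insert_erase (h hc), inter_insert, inf_eq_left.2 hle]

theorem isBase.of_inter_eq {S T : Finset (Fin n)} (hS : A.isBase S) (hcard : T.card = S.card)
    (h : A.inter T = A.inter S) : A.isBase T := by
  refine ⟨⟨h ▸ hS.1.1, by rw [h, hcard, hS.1.2]⟩, fun U hU hTU => ?_⟩
  by_contra hne
  obtain ⟨m, hmU, hmT⟩ := Finset.exists_of_ssubset (hTU.ssubset_of_ne hne)
  have hm : A.indep (insert m T) := hU.subset (Finset.insert_subset hmU hTU)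
  have hinter : A.inter (insert m S) = A.inter (insert m T) := by
    rw [inter_insert, inter_insert, h]
  have hcd : A.cd (A.inter (insert m S)) = S.card + 1 := by
    rw [hinter, hm.2, Finset.card_insert_of_notMem hmT, hcard]
  have hmS : m ∉ S := fun hmS => by
    rw [Finset.insert_eq_of_mem hmS, hS.1.2] at hcd
    omega
  have := hS.2 _ ⟨hinter ▸ hm.1, by rw [hcd, Finset.card_insert_of_notMem hmS]⟩
    (Finset.subset_insert m S)
  exact hmS (this ▸ Finset.mem_insert_self m S)

/-- If `S` is a base and `k` is joined to `T ⊆ S` in a circuit, then `k` can replace any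
element of `T` in `S`. -/
theorem isBase.exchange {S T : Finset (Fin n)} (hS : A.isBase S) (hTS : T ⊆ S) {j k : Fin n}
    (hC : A.circuit (insert k T)) (hj : j ∈ T) : A.isBase (insert k (S.erase j)) := by
  have hkS : k ∉ S := fun hk => by
    have hlt := hC.1.2
    rw [(hS.1.subset (Finset.insert_subset hk hTS)).2] at hlt
    exact hlt.false
  have hsub : insert k T ⊆ insert k S := Finset.insert_subset_insert k hTS
  have hjk : j ≠ k := fun h => hkS (h ▸ hTS hj)
  refine hS.of_inter_eq ?_ ?_
  · rw [Finset.card_insert_of_notMem fun h => hkS (Finset.mem_of_mem_erase h),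
      Finset.card_erase_add_one (hTS hj)]
  · have h₁ := hC.inter_erase_of_subset hsub (Finset.mem_insert_of_mem hj)
    have h₂ := hC.inter_erase_of_subset hsub (Finset.mem_insert_self k T)
    rw [Finset.erase_insert hkS] at h₂
    rw [← Finset.erase_insert_of_ne hjk.symm, h₁, h₂]

end Matroid

end HArr

open scoped Classical
/-- For an nbc-base `B` and `H ∈ B`, there is `H' < H` with
`(B ∖ {H}) ∪ {H'}` an nbc-base iff there is `H' < H` with `(B ∖ {H}) ∪ {H'}` a base. -/
theorem exists_nbcBase_iff_exists_base {W : Type} [AddCommGroup W] [Module ℂ W]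
    [FiniteDimensional ℂ W] {n : ℕ} (A : HArr W n) (B : Finset (Fin n))
    (hB : A.nbcBase 1 B) (i : Fin n) (hi : i ∈ B) :
    (∃ j, j < i ∧ A.nbcBase 1 (insert j (B.erase i))) ↔
      (∃ j, j < i ∧ A.isBase (insert j (B.erase i))) := by
  refine ⟨fun ⟨j, hj, h⟩ => ⟨j, hj, h.2⟩, fun hex => ?_⟩
  obtain ⟨j, ⟨hji, hbase⟩, hmin⟩ := exists_minimal_of_wellFoundedLT
    (fun j => j < i ∧ A.isBase (insert j (B.erase i))) hex
  refine ⟨j, hji, ⟨hbase.1.1, ?_⟩, hbase⟩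
  rintro T hT ⟨k, hkT, hlt, hC⟩
  have hjB : j ∉ B.erase i := fun hj => by
    rw [Finset.insert_eq_of_mem hj] at hbase
    have := hbase.2 B hB.2.1 (Finset.erase_subset i B)
    exact Finset.notMem_erase i B (this.symm ▸ hi)
  have hjT : j ∈ T := by
    by_contra hjT
    exact hB.1.2 T (((Finset.subset_insert_iff_of_notMem hjT).1 hT).trans
      (Finset.erase_subset i B)) ⟨k, hkT, hlt, hC⟩
  have hkj : k < j := hlt j hjT
  have hk := hbase.exchange hT hC hjT
  rw [Finset.erase_insert hjB] at hk
  exact (hmin ⟨hkj.trans hji, hk⟩ hkj.le).not_gt hkj
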